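/- Fix ρ ∈ (0,1] and a countable collection of languages 𝓛 : ℕ → Set ℕ (each 𝓛 i infinite). The following are equivalent: (i) there exists a set-based generator G : List ℕ → Set ℕ such that for every index i and every enumeration x of K := 𝓛 i with o(1)-noise and arbitrary omissions, G generates in the limit from K under x and liminf_{n→∞} μ_low(G(x_1,…,x_n), K) ≥ ρ; (ii) for every nonempty finite subcollection 𝓛' of {𝓛 i : i ∈ ℕ} whose intersection ⋂_{L ∈ 𝓛'} L is infinite, every L ∈ 𝓛' satisfies μ_low(⋂_{L' ∈ 𝓛'} L', L) ≥ ρ. -/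

import Mathlib

open Filter Set Topology

/-- The list `[x 0, …, x (n-1)]` of the first `n` elements of the stream `x`
(the paper's `x_1, …, x_n`). -/
def prefixList (x : ℕ → ℕ) (n : ℕ) : List ℕ := (List.range n).map x

/-- The set of the first `n` elements of the stream `x` (the paper's `{x_1, …, x_n}`). -/
def seen (x : ℕ → ℕ) (n : ℕ) : Set ℕ := x '' {t | t < n}

/-- The empirical noise rate `R(L; x_{1:n})` of the first `n` elements of `x` w.r.t. `L`. -/
noncomputable def noiseRate (L : Set ℕ) (x : ℕ → ℕ) (n : ℕ) : ℝ :=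
  (({t | t < n ∧ x t ∉ L}).ncard : ℝ) / n

/-- `|A ∩ {b_1, …, b_m}| / m` where `b_1 < b_2 < …` is the increasing enumeration of `B`. -/
noncomputable def densityRatio (A B : Set ℕ) (m : ℕ) : ℝ :=
  (({j | j < m ∧ Nat.nth (· ∈ B) j ∈ A}).ncard : ℝ) / m

/-- Lower density `μ_low(A, B)` of `A` in `B`. -/
noncomputable def lowDensity (A B : Set ℕ) : ℝ := Filter.liminf (densityRatio A B) Filter.atTop

/-- Upper density `μ_up(A, B)` of `A` in `B`. -/
noncomputable def upDensity (A B : Set ℕ) : ℝ := Filter.limsup (densityRatio A B) Filter.atTop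

lemma nonneg_densityRatio (A B : Set ℕ) (m : ℕ) : 0 ≤ densityRatio A B m := by
  unfold densityRatio
  positivity

lemma densityRatio_le_one (A B : Set ℕ) (m : ℕ) : densityRatio A B m ≤ 1 := by
  refine div_le_one_of_le₀ ?_ (by positivity)
  have h := Set.ncard_le_ncard (s := {j | j < m ∧ Nat.nth (· ∈ B) j ∈ A}) (t := Set.Iio m)
    (fun j hj => hj.1) (Set.finite_Iio m)
  rw [Set.ncard_Iio_nat] at h
  exact_mod_cast h

lemma isBoundedUnder_ge_densityRatio (A B : Set ℕ) :
    IsBoundedUnder (· ≥ ·) atTop (densityRatio A B) :=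
  isBoundedUnder_of ⟨0, nonneg_densityRatio A B⟩

lemma isCoboundedUnder_ge_densityRatio (A B : Set ℕ) :
    IsCoboundedUnder (· ≥ ·) atTop (densityRatio A B) :=
  IsBoundedUnder.isCoboundedUnder_ge (isBoundedUnder_of ⟨1, densityRatio_le_one A B⟩)

lemma lowDensity_nonneg (A B : Set ℕ) : 0 ≤ lowDensity A B :=
  le_liminf_of_le (isCoboundedUnder_ge_densityRatio A B)
    (Eventually.of_forall (nonneg_densityRatio A B))

lemma lowDensity_le_one (A B : Set ℕ) : lowDensity A B ≤ 1 :=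
  liminf_le_of_frequently_le (Frequently.of_forall (densityRatio_le_one A B))
    (isBoundedUnder_ge_densityRatio A B)

lemma lowDensity_mono {A A' : Set ℕ} (h : A ⊆ A') (B : Set ℕ) :
    lowDensity A B ≤ lowDensity A' B := by
  refine liminf_le_liminf (Eventually.of_forall fun m => ?_)
    (isBoundedUnder_ge_densityRatio A B) (isCoboundedUnder_ge_densityRatio A' B)
  unfold densityRatio
  gcongr
  exact (Set.finite_Iio m).subset fun j hj => hj.1

lemma densityRatio_le_diff_add {A B F : Set ℕ} (hB : B.Infinite) (hF : F.Finite) (m : ℕ) :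
    densityRatio A B m ≤ densityRatio (A \ F) B m + F.ncard / m := by
  unfold densityRatio
  rw [← add_div]
  gcongr
  have hinj : Function.Injective (Nat.nth (· ∈ B)) := Nat.nth_injective hB
  have h₁ : ((Nat.nth (· ∈ B)) ⁻¹' F).Finite := hF.preimage hinj.injOn
  have h₂ : ((Nat.nth (· ∈ B)) ⁻¹' F).ncard ≤ F.ncard :=
    Set.ncard_le_ncard_of_injOn _ (fun _ h => h) hinj.injOn hF
  have h₃ : {j | j < m ∧ Nat.nth (· ∈ B) j ∈ A \ F}.Finite :=
    (Set.finite_Iio m).subset fun j hj => hj.1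
  have h₄ := Set.ncard_le_ncard (s := {j | j < m ∧ Nat.nth (· ∈ B) j ∈ A})
    (t := {j | j < m ∧ Nat.nth (· ∈ B) j ∈ A \ F} ∪ (Nat.nth (· ∈ B)) ⁻¹' F)
    (fun j hj => by
      by_cases hjF : Nat.nth (· ∈ B) j ∈ F
      · exact Or.inr hjF
      · exact Or.inl ⟨hj.1, hj.2, hjF⟩) (h₃.union h₁)
  exact_mod_cast (h₄.trans (Set.ncard_union_le _ _)).trans (Nat.add_le_add_left h₂ _)

/-- Removing finitely many elements does not decrease the lower density. -/
lemma lowDensity_le_diff {A B F : Set ℕ} (hB : B.Infinite) (hF : F.Finite) :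
    lowDensity A B ≤ lowDensity (A \ F) B := by
  refine le_of_forall_lt fun c hc => ?_
  obtain ⟨d, hcd, hd⟩ := exists_between hc
  obtain ⟨e, hce, hed⟩ := exists_between hcd
  refine hce.trans_le (le_liminf_of_le (isCoboundedUnder_ge_densityRatio _ _) ?_)
  have h₁ := eventually_lt_of_lt_liminf hd (isBoundedUnder_ge_densityRatio A B)
  have h₂ := (tendsto_const_div_atTop_nhds_zero_nat (F.ncard : ℝ)).eventually_lt_const
    (sub_pos.2 hed)
  filter_upwards [h₁, h₂] with m hm₁ hm₂
  linarith [densityRatio_le_diff_add (A := A) hB hF m]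

lemma isBoundedUnder_ge_lowDensity (A : ℕ → Set ℕ) (B : Set ℕ) :
    IsBoundedUnder (· ≥ ·) atTop (fun n => lowDensity (A n) B) :=
  isBoundedUnder_of ⟨0, fun n => lowDensity_nonneg (A n) B⟩

lemma isCoboundedUnder_ge_lowDensity (A : ℕ → Set ℕ) (B : Set ℕ) :
    IsCoboundedUnder (· ≥ ·) atTop (fun n => lowDensity (A n) B) :=
  IsBoundedUnder.isCoboundedUnder_ge (isBoundedUnder_of ⟨1, fun n => lowDensity_le_one (A n) B⟩)

lemma finite_seen (x : ℕ → ℕ) (n : ℕ) : (seen x n).Finite :=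
  (Set.finite_Iio n).image x

lemma seen_congr {x y : ℕ → ℕ} {n : ℕ} (h : ∀ t < n, x t = y t) : seen x n = seen y n :=
  Set.image_congr h

lemma noiseRate_congr (L : Set ℕ) {x y : ℕ → ℕ} {n : ℕ} (h : ∀ t < n, x t = y t) :
    noiseRate L x n = noiseRate L y n := by
  unfold noiseRate
  congr 3
  ext t
  exact and_congr_right fun ht => by rw [h t ht]

/-- The noise level tolerated for the `j`-th language; these levels sum to at most `1 / 2`. -/
noncomputable def noiseTolerance (j : ℕ) : ℝ := (1 / 2) ^ j / 4

lemma noiseTolerance_pos (j : ℕ) : 0 < noiseTolerance j := by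
  unfold noiseTolerance
  positivity

lemma sum_noiseTolerance_le (T : Finset ℕ) : ∑ j ∈ T, noiseTolerance j ≤ 1 / 2 := by
  have hT : T ⊆ Finset.range (T.sup id + 1) := fun j hj =>
    Finset.mem_range.2 (Nat.lt_succ_of_le (Finset.le_sup (f := id) hj))
  have h₁ := Finset.sum_le_sum_of_subset_of_nonneg hT fun j _ _ => (noiseTolerance_pos j).le
  have h₂ := sum_geometric_two_le (T.sup id + 1)
  have h₃ : ∑ j ∈ Finset.range (T.sup id + 1), noiseTolerance j
      = (∑ j ∈ Finset.range (T.sup id + 1), (1 / 2 : ℝ) ^ j) / 4 := by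
    simp only [noiseTolerance, Finset.sum_div]
  linarith

/-- Finitely many languages whose noise rates are eventually within tolerance have infinite
intersection. -/
lemma infinite_iInter_of_eventually_noiseRate_le {𝓛 : ℕ → Set ℕ} {x : ℕ → ℕ}
    (hx : Function.Injective x) (T : Finset ℕ)
    (hT : ∀ j ∈ T, ∀ᶠ n in atTop, noiseRate (𝓛 j) x n ≤ noiseTolerance j) :
    (⋂ j ∈ T, 𝓛 j).Infinite := by
  intro hfin
  have hev := (T.eventually_all).2 hT
  obtain ⟨n, hn, hlarge⟩ := (hev.and (eventually_gt_atTop (2 * (⋂ j ∈ T, 𝓛 j).ncard))).exists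
  have hn0 : (0 : ℝ) < n := by exact_mod_cast (Nat.zero_le _).trans_lt hlarge
  have hpre : (x ⁻¹' ⋂ j ∈ T, 𝓛 j).Finite := hfin.preimage hx.injOn
  have hpre_card : (x ⁻¹' ⋂ j ∈ T, 𝓛 j).ncard ≤ (⋂ j ∈ T, 𝓛 j).ncard :=
    Set.ncard_le_ncard_of_injOn x (fun _ h => h) hx.injOn hfin
  have hnoise (j : ℕ) : {t | t < n ∧ x t ∉ 𝓛 j}.Finite :=
    (Set.finite_Iio n).subset fun t ht => ht.1
  have hcover : Set.Iio n ⊆ (x ⁻¹' ⋂ j ∈ T, 𝓛 j) ∪ ⋃ j ∈ T, {t | t < n ∧ x t ∉ 𝓛 j} := by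
    intro t ht
    by_cases h : x t ∈ ⋂ j ∈ T, 𝓛 j
    · exact Or.inl h
    · simp only [Set.mem_iInter, not_forall] at h
      obtain ⟨j, hj, hxj⟩ := h
      exact Or.inr (Set.mem_biUnion hj ⟨ht, hxj⟩)
  have hcard := Set.ncard_le_ncard hcover
    (hpre.union (T.finite_toSet.biUnion fun j _ => hnoise j))
  rw [Set.ncard_Iio_nat] at hcard
  have hcard' : n ≤ (⋂ j ∈ T, 𝓛 j).ncard + ∑ j ∈ T, {t | t < n ∧ x t ∉ 𝓛 j}.ncard :=
    hcard.trans ((Set.ncard_union_le _ _).trans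
      (Nat.add_le_add hpre_card (Finset.set_ncard_biUnion_le _ _)))
  have hsum : ∑ j ∈ T, ({t | t < n ∧ x t ∉ 𝓛 j}.ncard : ℝ) ≤ (∑ j ∈ T, noiseTolerance j) * n := by
    rw [Finset.sum_mul]
    exact Finset.sum_le_sum fun j hj => (div_le_iff₀ hn0).1 (hn j hj)
  have hcardR : (n : ℝ) ≤ (⋂ j ∈ T, 𝓛 j).ncard +
      ∑ j ∈ T, ({t | t < n ∧ x t ∉ 𝓛 j}.ncard : ℝ) := by exact_mod_cast hcard'
  have hlargeR : 2 * ((⋂ j ∈ T, 𝓛 j).ncard : ℝ) < n := by exact_mod_cast hlarge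
  have := mul_le_mul_of_nonneg_right (sum_noiseTolerance_le T) hn0.le
  linarith

open Classical in
/-- The priority of the `j`-th language at time `n`: its index plus the number of earlier times at
which its noise rate exceeded its tolerance. -/
noncomputable def priority (𝓛 : ℕ → Set ℕ) (x : ℕ → ℕ) (n j : ℕ) : ℕ :=
  j + Nat.count (fun t => noiseTolerance j < noiseRate (𝓛 j) x t) n

/-- The languages of priority at most `q` at time `n`. -/
noncomputable def preferred (𝓛 : ℕ → Set ℕ) (x : ℕ → ℕ) (n q : ℕ) : Finset ℕ :=
  {j ∈ Finset.range (q + 1) | priority 𝓛 x n j ≤ q}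

open Classical in
/-- The largest priority level, at most `n`, whose preferred languages have infinite
intersection. -/
noncomputable def cutoff (𝓛 : ℕ → Set ℕ) (x : ℕ → ℕ) (n : ℕ) : ℕ :=
  Nat.findGreatest (fun q => (⋂ j ∈ preferred 𝓛 x n q, 𝓛 j).Infinite) n

/-- The set generated at time `n`: the unseen part of the intersection of the preferred
languages at the cutoff level. -/
noncomputable def generated (𝓛 : ℕ → Set ℕ) (x : ℕ → ℕ) (n : ℕ) : Set ℕ :=
  (⋂ j ∈ preferred 𝓛 x n (cutoff 𝓛 x n), 𝓛 j) \ seen x n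

lemma generated_congr (𝓛 : ℕ → Set ℕ) {x y : ℕ → ℕ} {n : ℕ} (h : ∀ t < n, x t = y t) :
    generated 𝓛 x n = generated 𝓛 y n := by
  have hprio : priority 𝓛 x n = priority 𝓛 y n := by
    funext j
    unfold priority
    simp only [Nat.count_eq_card_filter_range]
    congr 2
    refine Finset.filter_congr fun t ht => ?_
    rw [noiseRate_congr (𝓛 j) fun s hs => h s (hs.trans (Finset.mem_range.1 ht))]
  have hpref : preferred 𝓛 x n = preferred 𝓛 y n := by
    funext q
    simp only [preferred, hprio]
  have hcut : cutoff 𝓛 x n = cutoff 𝓛 y n := by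
    unfold cutoff
    congr 1
    funext q
    rw [hpref]
  simp only [generated, hcut, hpref, seen_congr h]

lemma generated_prefixList (𝓛 : ℕ → Set ℕ) (x : ℕ → ℕ) (n : ℕ) :
    generated 𝓛 (fun t => (prefixList x n).getD t 0) (prefixList x n).length
      = generated 𝓛 x n := by
  have hlen : (prefixList x n).length = n := by simp [prefixList]
  rw [hlen]
  refine generated_congr 𝓛 fun t ht => ?_
  simp [prefixList, ht]

lemma infinite_iInter_preferred_cutoff {𝓛 : ℕ → Set ℕ} (hinf : ∀ i, (𝓛 i).Infinite)
    (x : ℕ → ℕ) (n : ℕ) : (⋂ j ∈ preferred 𝓛 x n (cutoff 𝓛 x n), 𝓛 j).Infinite := by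
  classical
  have h0 : (⋂ j ∈ preferred 𝓛 x n 0, 𝓛 j).Infinite := by
    refine (hinf 0).mono (Set.subset_iInter₂ fun j hj => ?_)
    have : j = 0 := by simpa using Finset.mem_of_mem_filter j hj
    rw [this]
  exact Nat.findGreatest_spec (P := fun q => (⋂ j ∈ preferred 𝓛 x n q, 𝓛 j).Infinite)
    (Nat.zero_le n) h0

/-- A language whose noise rate tends to zero is eventually preferred at the cutoff level. -/
lemma eventually_mem_preferred_cutoff {𝓛 : ℕ → Set ℕ} {x : ℕ → ℕ}
    (hx : Function.Injective x) {i : ℕ} (hi : Tendsto (noiseRate (𝓛 i) x) atTop (𝓝 0)) :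
    ∀ᶠ n in atTop, i ∈ preferred 𝓛 x n (cutoff 𝓛 x n) := by
  classical
  obtain ⟨N, hN⟩ := eventually_atTop.1 (hi.eventually_lt_const (noiseTolerance_pos i))
  have hprio (n : ℕ) : priority 𝓛 x n i ≤ i + N := by
    unfold priority
    rw [Nat.count_eq_card_filter_range]
    gcongr
    refine (Finset.card_le_card fun t ht => ?_).trans (Finset.card_range N).le
    by_contra h
    exact (hN t (by simpa using h)).not_gt (Finset.mem_filter.1 ht).2
  have hbad : ∀ j, (¬ ∀ᶠ n in atTop, noiseRate (𝓛 j) x n ≤ noiseTolerance j) →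
      ∀ᶠ n in atTop, i + N < priority 𝓛 x n j := by
    intro j hj
    have hfreq : {t | noiseTolerance j < noiseRate (𝓛 j) x t}.Infinite := by
      rw [← Nat.frequently_atTop_iff_infinite]
      exact (not_eventually.1 hj).mono fun _ => lt_of_not_ge
    filter_upwards [eventually_ge_atTop
      (Nat.nth (fun t => noiseTolerance j < noiseRate (𝓛 j) x t) (i + N + 1))] with n hn
    have h := Nat.count_monotone (fun t => noiseTolerance j < noiseRate (𝓛 j) x t) hn
    rw [Nat.count_nth_of_infinite hfreq] at h
    unfold priority
    omega
  have hbad' : ∀ᶠ n in atTop, ∀ j ∈ Finset.range (i + N + 1),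
      (¬ ∀ᶠ n in atTop, noiseRate (𝓛 j) x n ≤ noiseTolerance j) → i + N < priority 𝓛 x n j :=
    (Finset.eventually_all _).2 fun j _ => by
      by_cases h : ∀ᶠ n in atTop, noiseRate (𝓛 j) x n ≤ noiseTolerance j
      · exact Eventually.of_forall fun _ h' => absurd h h'
      · exact (hbad j h).mono fun _ hn _ => hn
  have hgood := infinite_iInter_of_eventually_noiseRate_le (𝓛 := 𝓛) hx
    {j ∈ Finset.range (i + N + 1) | ∀ᶠ n in atTop, noiseRate (𝓛 j) x n ≤ noiseTolerance j}
    fun j hj => (Finset.mem_filter.1 hj).2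
  filter_upwards [hbad', eventually_ge_atTop (i + N)] with n hn hle
  have hlevel : (⋂ j ∈ preferred 𝓛 x n (i + N), 𝓛 j).Infinite := by
    refine hgood.mono (Set.biInter_subset_biInter_left fun j hj => ?_)
    obtain ⟨hjr, hjp⟩ := Finset.mem_filter.1 hj
    refine Finset.mem_filter.2 ⟨hjr, ?_⟩
    by_contra h
    exact (hn j hjr h).not_ge hjp
  have hcut : i + N ≤ cutoff 𝓛 x n := Nat.le_findGreatest hle hlevel
  exact Finset.mem_filter.2 ⟨Finset.mem_range.2 (by omega), (hprio n).trans hcut⟩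

/-- Characterization of set-based lower density `ρ` generation under `o(1)`-noise and
arbitrary omissions. -/
theorem set_based_density_vanishing_noise_characterization
    (ρ : ℝ) (hρ : ρ ∈ Set.Ioc (0:ℝ) 1) (𝓛 : ℕ → Set ℕ) (hinf : ∀ i, (𝓛 i).Infinite) :
    (∃ G : List ℕ → Set ℕ, ∀ i : ℕ, ∀ x : ℕ → ℕ,
      Function.Injective x →
      {n : ℕ | x n ∈ 𝓛 i}.Infinite →
      Filter.Tendsto (noiseRate (𝓛 i) x) Filter.atTop (nhds 0) →
      (∃ nstar : ℕ, ∀ n ≥ nstar, G (prefixList x n) ⊆ 𝓛 i \ seen x n) ∧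
      Filter.liminf (fun n => lowDensity (G (prefixList x n)) (𝓛 i)) Filter.atTop ≥ ρ)
    ↔
    (∀ s : Finset ℕ, s.Nonempty → (⋂ i ∈ s, 𝓛 i).Infinite →
      ∀ i ∈ s, lowDensity (⋂ j ∈ s, 𝓛 j) (𝓛 i) ≥ ρ) := by
  constructor
  · rintro ⟨G, hG⟩ s - hs i hi
    set I := ⋂ j ∈ s, 𝓛 j
    let x := Nat.nth (· ∈ I)
    have hx : Function.Injective x := Nat.nth_injective hs
    have hmem (j : ℕ) (hj : j ∈ s) (n : ℕ) : x n ∈ 𝓛 j :=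
      Set.biInter_subset_of_mem (t := 𝓛) hj (Nat.nth_mem_of_infinite hs n)
    have hgen (j : ℕ) (hj : j ∈ s) := hG j x hx (by simpa [hmem j hj] using Set.infinite_univ) (by
      have h0 : noiseRate (𝓛 j) x = fun _ => 0 := by
        funext n
        simp [noiseRate, hmem j hj]
      rw [h0]
      exact tendsto_const_nhds)
    have hsub : ∀ᶠ n in atTop, ∀ j ∈ s, G (prefixList x n) ⊆ 𝓛 j :=
      s.eventually_all.2 fun j hj =>
        (eventually_atTop.2 (hgen j hj).1).mono fun _ h => h.trans Set.sdiff_subset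
    refine (hgen i hi).2.le.trans (liminf_le_of_frequently_le (Eventually.frequently ?_)
      (isBoundedUnder_ge_lowDensity _ _))
    filter_upwards [hsub] with n hn
    exact lowDensity_mono (Set.subset_iInter₂ hn) _
  · intro h
    refine ⟨fun l => generated 𝓛 (fun t => l.getD t 0) l.length, fun i x hx _ hnoise => ?_⟩
    simp only [generated_prefixList]
    have hev := eventually_mem_preferred_cutoff hx hnoise
    refine ⟨eventually_atTop.1 (hev.mono fun n hn => ?_), ?_⟩
    · exact Set.sdiff_subset_sdiff_left (Set.biInter_subset_of_mem (t := 𝓛) hn)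
    · refine le_liminf_of_le (isCoboundedUnder_ge_lowDensity _ _) (hev.mono fun n hn => ?_)
      exact (h _ ⟨i, hn⟩ (infinite_iInter_preferred_cutoff hinf x n) i hn).le.trans
        (lowDensity_le_diff (hinf i) (finite_seen x n))
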